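/- arXiv:1207.3132 — 3 statements merged into one kernel-verified Lean document; each statement's English description precedes it below -/
import Mathlib

section
/- Let p be an odd prime, let F be a finite field of cardinality q with p not dividing q, let t be the multiplicative order of q modulo p, and suppose p^2 does not divide q^t − 1. Then for every m ≥ 1 and every cyclic code C of length p^m over F, p^{2m−1} divides the order of Aut(C). -/
/-- The action of a permutation `σ` of `ZMod n` on words: `(σ · c)(i) = c (σ⁻¹ i)`. -/
def permAction {F : Type*} {n : ℕ} (σ : Equiv.Perm (ZMod n)) (c : ZMod n → F) : ZMod n → F :=
  fun i => c (σ⁻¹ i)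

/-- A cyclic code of length `n` over `F`: a linear code closed under the cyclic shift. -/
def IsCyclicCode {F : Type*} [Field F] {n : ℕ} (C : Submodule F (ZMod n → F)) : Prop :=
  ∀ c ∈ C, (fun i => c (i - 1)) ∈ C

/-- The automorphism group of a code: all permutations `σ` with `σ · C = C`. -/
def autCode {F : Type*} [Field F] {n : ℕ} (C : Submodule F (ZMod n → F)) :
    Subgroup (Equiv.Perm (ZMod n)) where
  carrier := {σ | ∀ c : ZMod n → F, permAction σ c ∈ C ↔ c ∈ C}
  one_mem' := by
    intro c
    have h : permAction (1 : Equiv.Perm (ZMod n)) c = c := by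
      funext i; simp [permAction]
    rw [h]
  mul_mem' := by
    intro σ τ hσ hτ c
    have h : permAction (σ * τ) c = permAction σ (permAction τ c) := by
      funext i; simp [permAction]
    rw [h, hσ, hτ]
  inv_mem' := by
    intro σ hσ c
    have h1 : permAction σ (permAction σ⁻¹ c) = c := by
      funext i; simp [permAction]
    have h2 := hσ (permAction σ⁻¹ c)
    rw [h1] at h2
    exact h2.symm

/-- The multiplier permutation `μ_u : x ↦ u * x` for a unit `u` of `ZMod n`. -/
def multPerm {n : ℕ} (u : (ZMod n)ˣ) : Equiv.Perm (ZMod n) where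
  toFun x := (u : ZMod n) * x
  invFun x := ((u⁻¹ : (ZMod n)ˣ) : ZMod n) * x
  left_inv x := by simp [← mul_assoc]
  right_inv x := by simp [← mul_assoc]

/-- The cyclic shift of words as a linear map. -/
def cyclicShift (F : Type*) [Field F] (n : ℕ) : Module.End F (ZMod n → F) :=
  LinearMap.funLeft F F (fun i => i - 1)

/-- The action of a permutation on words as a linear map. -/
def permLinear (F : Type*) [Field F] {n : ℕ} (σ : Equiv.Perm (ZMod n)) :
    Module.End F (ZMod n → F) :=
  LinearMap.funLeft F F (σ⁻¹ : Equiv.Perm (ZMod n))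

section Codes

variable {F : Type*} [Field F] {n : ℕ}

theorem cyclicShift_pow_apply (k : ℕ) (c : ZMod n → F) (i : ZMod n) :
    (cyclicShift F n ^ k) c i = c (i - k) := by
  induction k generalizing i with
  | zero => simp
  | succ k ih =>
    rw [pow_succ', Module.End.mul_apply]
    change (cyclicShift F n ^ k) c (i - 1) = _
    rw [ih]
    congr 1
    push_cast
    ring

theorem cyclicShift_pow_single (k : ℕ) (a : F) :
    (cyclicShift F n ^ k) (Pi.single 0 a) = Pi.single (k : ZMod n) a := by
  funext i
  rw [cyclicShift_pow_apply]
  simp [Pi.single_apply, sub_eq_zero]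

theorem exists_aeval_cyclicShift_eq [NeZero n] (c : ZMod n → F) :
    ∃ P : Polynomial F, Polynomial.aeval (cyclicShift F n) P (Pi.single 0 1) = c := by
  refine ⟨∑ i : ZMod n, Polynomial.C (c i) * Polynomial.X ^ i.val, ?_⟩
  funext j
  simp [cyclicShift_pow_single, Module.algebraMap_end_apply, Finset.sum_apply, Pi.single_apply]

theorem IsCyclicCode.aeval_mem {C : Submodule F (ZMod n → F)} (hC : IsCyclicCode C)
    (P : Polynomial F) {c : ZMod n → F} (hc : c ∈ C) :
    Polynomial.aeval (cyclicShift F n) P c ∈ C := by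
  have hpow : ∀ k : ℕ, (cyclicShift F n ^ k) c ∈ C := by
    intro k
    induction k with
    | zero => simpa
    | succ k ih =>
      rw [pow_succ', Module.End.mul_apply]
      exact hC _ ih
  rw [Polynomial.aeval_eq_sum_range, LinearMap.sum_apply]
  exact C.sum_mem fun k _ => C.smul_mem _ (hpow k)

theorem permLinear_multPerm_comp_cyclicShift {q : ℕ} (u : (ZMod n)ˣ)
    (hu : (u : ZMod n) = q) :
    permLinear F (multPerm u) * cyclicShift F n =
      cyclicShift F n ^ q * permLinear F (multPerm u) := by
  ext1 c
  funext i
  rw [Module.End.mul_apply, Module.End.mul_apply, cyclicShift_pow_apply]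
  change c ((u⁻¹ : (ZMod n)ˣ) * i - 1) = c ((u⁻¹ : (ZMod n)ˣ) * (i - q))
  rw [mul_sub, ← hu, Units.inv_mul]

theorem permLinear_multPerm_single (u : (ZMod n)ˣ) :
    permLinear F (multPerm u) (Pi.single 0 1) = Pi.single 0 1 := by
  funext i
  change (Pi.single 0 1 : ZMod n → F) ((u⁻¹ : (ZMod n)ˣ) * i) = _
  simp [Pi.single_apply]

theorem permLinear_multPerm_aeval {q : ℕ} (u : (ZMod n)ˣ) (hu : (u : ZMod n) = q)
    (P : Polynomial F) (c : ZMod n → F) :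
    permLinear F (multPerm u) (Polynomial.aeval (cyclicShift F n) P c) =
      Polynomial.aeval (cyclicShift F n) (Polynomial.expand F q P)
        (permLinear F (multPerm u) c) := by
  have hpow : ∀ k : ℕ, permLinear F (multPerm u) * cyclicShift F n ^ k =
      (cyclicShift F n ^ q) ^ k * permLinear F (multPerm u) := fun k =>
    SemiconjBy.pow_right (permLinear_multPerm_comp_cyclicShift u hu) k
  rw [Polynomial.expand_aeval, Polynomial.aeval_eq_sum_range, Polynomial.aeval_eq_sum_range,
    LinearMap.sum_apply, LinearMap.sum_apply, map_sum]
  refine Finset.sum_congr rfl fun k _ => ?_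
  rw [LinearMap.smul_apply, LinearMap.smul_apply, map_smul, ← Module.End.mul_apply, hpow,
    Module.End.mul_apply]

/-- A permutation of coordinates that maps a code into itself is an automorphism of it. -/
theorem mem_autCode_of_forall_mem [NeZero n] {C : Submodule F (ZMod n → F)}
    {σ : Equiv.Perm (ZMod n)} (h : ∀ c ∈ C, permAction σ c ∈ C) : σ ∈ autCode C := by
  have hmul : ∀ (τ ρ : Equiv.Perm (ZMod n)) (c : ZMod n → F),
      permAction (τ * ρ) c = permAction τ (permAction ρ c) := fun τ ρ c => by
    funext i
    simp [permAction]
  have hpow : ∀ (k : ℕ), ∀ c ∈ C, permAction (σ ^ k) c ∈ C := by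
    intro k
    induction k with
    | zero => exact fun c hc => hc
    | succ k ih =>
      intro c hc
      rw [pow_succ, hmul]
      exact ih _ (h c hc)
  refine fun c => ⟨fun hc => ?_, h c⟩
  obtain ⟨k, hk⟩ := mem_powers_iff_mem_zpowers.mpr (inv_mem (Subgroup.mem_zpowers σ))
  have hmem := hpow k _ hc
  rw [← hmul] at hmem
  simp only at hk
  rw [hk, inv_mul_cancel] at hmem
  exact hmem

/-- Multiplication by the cardinality of the field is an automorphism of every cyclic code. -/
theorem multPerm_mem_autCode [Fintype F] [NeZero n] {C : Submodule F (ZMod n → F)}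
    (hC : IsCyclicCode C) (u : (ZMod n)ˣ) (hu : (u : ZMod n) = Fintype.card F) :
    multPerm u ∈ autCode C := by
  refine mem_autCode_of_forall_mem fun c hc => ?_
  change permLinear F (multPerm u) c ∈ C
  obtain ⟨P, hP⟩ := exists_aeval_cyclicShift_eq c
  rw [← hP, permLinear_multPerm_aeval u hu, permLinear_multPerm_single, FiniteField.expand_card,
    ← Nat.sub_add_cancel (Fintype.card_pos (α := F)), pow_add, pow_one, map_mul,
    Module.End.mul_apply, hP]
  exact hC.aeval_mem _ hc

theorem addRight_mem_autCode [NeZero n] {C : Submodule F (ZMod n → F)} (hC : IsCyclicCode C)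
    (a : ZMod n) : Equiv.addRight a ∈ autCode C := by
  refine mem_autCode_of_forall_mem fun c hc => ?_
  have h := hC.aeval_mem (Polynomial.X ^ a.val) hc
  rw [map_pow, Polynomial.aeval_X] at h
  convert h using 1
  funext i
  rw [cyclicShift_pow_apply]
  simp [permAction, sub_eq_add_neg]

theorem orderOf_multPerm (u : (ZMod n)ˣ) : orderOf (multPerm u) = orderOf u := by
  let f : (ZMod n)ˣ →* Equiv.Perm (ZMod n) := MonoidHom.mk' multPerm fun a b => by
    ext1 x
    simp [multPerm, mul_assoc]
  refine orderOf_injective f (fun a b hab => ?_) u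
  have h : multPerm a 1 = multPerm b 1 := congrArg (fun σ => σ 1) hab
  exact Units.ext (by simpa [multPerm] using h)

/-- The order of the automorphism group of a cyclic code of length `n` over a field with `q`
elements is divisible by `n` times the multiplicative order of `q` modulo `n`. -/
theorem mul_orderOf_dvd_card_autCode [Fintype F] [NeZero n] {C : Submodule F (ZMod n → F)}
    (hC : IsCyclicCode C) (u : (ZMod n)ˣ) (hu : (u : ZMod n) = Fintype.card F) :
    n * orderOf u ∣ Nat.card (autCode C) := by
  have horbit : MulAction.orbit (autCode C) (0 : ZMod n) = Set.univ := by
    refine Set.eq_univ_of_forall fun a => ⟨⟨_, addRight_mem_autCode hC a⟩, ?_⟩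
    change (0 : ZMod n) + a = a
    exact zero_add a
  have hcard := (MulAction.stabilizer (autCode C) (0 : ZMod n)).index_mul_card
  rw [MulAction.index_stabilizer, horbit, Set.ncard_univ, Nat.card_zmod] at hcard
  rw [← hcard]
  refine Nat.mul_dvd_mul_left n ?_
  let g : autCode C := ⟨multPerm u, multPerm_mem_autCode hC u hu⟩
  have hg : g ∈ MulAction.stabilizer (autCode C) (0 : ZMod n) :=
    mul_zero (u : ZMod n)
  have hdvd := Subgroup.orderOf_dvd_natCard _ hg
  rwa [← Subgroup.orderOf_coe, orderOf_multPerm] at hdvd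

end Codes

theorem prime_pow_dvd_orderOf_natCast {p q : ℕ} (hp : p.Prime) (hodd : Odd p) (hpq : ¬ p ∣ q)
    (hz : ¬ p ^ 2 ∣ q ^ orderOf (q : ZMod p) - 1) (k : ℕ) :
    p ^ k ∣ orderOf (q : ZMod (p ^ (k + 1))) := by
  have hp2 : p ≠ 2 := by
    rintro rfl
    exact absurd hodd (by decide)
  have hq : 1 ≤ q ^ orderOf (q : ZMod p) :=
    Nat.one_le_pow _ _ (Nat.pos_of_ne_zero fun h => hpq (h ▸ dvd_zero p))
  have hdvd : p ∣ q ^ orderOf (q : ZMod p) - 1 := by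
    rw [← CharP.cast_eq_zero_iff (ZMod p) p, Nat.cast_sub hq]
    simp [pow_orderOf_eq_one]
  obtain ⟨a, ha⟩ := hdvd
  have hpa : ¬ (p : ℤ) ∣ (a : ℤ) := fun h => hz <| by
    rw [ha, sq]
    exact Nat.mul_dvd_mul_left p (Int.natCast_dvd_natCast.mp h)
  have hpow : (q : ZMod (p ^ (k + 1))) ^ orderOf (q : ZMod p) =
      1 + p * ((a : ℤ) : ZMod (p ^ (k + 1))) := by
    have h : q ^ orderOf (q : ZMod p) = 1 + p * a := by omega
    have h' := congrArg (Nat.cast : ℕ → ZMod (p ^ (k + 1))) h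
    push_cast at h' ⊢
    exact h'
  rw [← ZMod.orderOf_one_add_mul_prime hp hp2 a hpa k, ← hpow]
  exact orderOf_pow_dvd _

/-- Let `p` be an odd prime, `F` a finite field of cardinality `q` with `p ∤ q`,
`t` the multiplicative order of `q` modulo `p`, and suppose `p^2 ∤ q^t - 1`. Then for
every `m ≥ 1` and every cyclic code `C` of length `p^m` over `F`, `p^(2m-1)` divides
the order of `Aut(C)`. -/
theorem stmt_4 (p : ℕ) (hp : p.Prime) (hodd : Odd p)
    (F : Type*) [Field F] [Fintype F] (q : ℕ) (hq : Fintype.card F = q)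
    (hpq : ¬ p ∣ q) (t : ℕ) (ht : t = orderOf ((q : ZMod p)))
    (hz : ¬ (p ^ 2 ∣ q ^ t - 1)) (m : ℕ) (hm : 1 ≤ m)
    (C : Submodule F (ZMod (p ^ m) → F)) (hC : IsCyclicCode C) :
    p ^ (2 * m - 1) ∣ Nat.card (autCode C) := by
  subst hq ht
  obtain ⟨k, rfl⟩ := Nat.exists_eq_add_of_le' hm
  have : NeZero (p ^ (k + 1)) := ⟨pow_ne_zero _ hp.ne_zero⟩
  have hcop : (Fintype.card F).Coprime (p ^ (k + 1)) :=
    (((Nat.Prime.coprime_iff_not_dvd hp).mpr hpq).pow_left _).symm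
  have hu := ZMod.coe_unitOfCoprime _ hcop
  refine dvd_trans ?_ (mul_orderOf_dvd_card_autCode hC _ hu)
  rw [← orderOf_units, hu, show 2 * (k + 1) - 1 = (k + 1) + k by omega, pow_add]
  exact Nat.mul_dvd_mul_left _ (prime_pow_dvd_orderOf_natCast hp hodd hpq hz k)
end

section
/- Let p be an odd prime, m > 1, and 1 ≤ n < p − 1. The normalizer of the subgroup Q_1^n in the group S_{p^m} of permutations of ZMod p^m equals Q^{n+1}, i.e., N_{S_{p^m}}(Q_1^n) = Q^{n+1}. -/
/-- The set `Q^n ⊆ S_{p^m}`: permutations of `ZMod (p^m)` given by a polynomial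
`f(x) = a₀ + a₁ x + ⋯ + aₙ xⁿ` with `a₁` a unit and `p^(m-1) ∣ aᵢ` for `2 ≤ i ≤ n`. -/
def QSet (p m n : ℕ) : Set (Equiv.Perm (ZMod (p ^ m))) :=
  {f | ∃ a : ℕ → ZMod (p ^ m),
    (∀ x, f x = ∑ i ∈ Finset.range (n + 1), a i * x ^ i) ∧
    IsUnit (a 1) ∧
    ∀ i, 2 ≤ i → i ≤ n → ((p : ZMod (p ^ m)) ^ (m - 1)) ∣ a i}

/-- The set `Q₁^n ⊆ Q^n`: those polynomial permutations with `a₁ ≡ 1 (mod p^(m-1))`. -/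
def Q1Set (p m n : ℕ) : Set (Equiv.Perm (ZMod (p ^ m))) :=
  {f | ∃ a : ℕ → ZMod (p ^ m),
    (∀ x, f x = ∑ i ∈ Finset.range (n + 1), a i * x ^ i) ∧
    IsUnit (a 1) ∧
    ((p : ZMod (p ^ m)) ^ (m - 1)) ∣ (a 1 - 1) ∧
    ∀ i, 2 ≤ i → i ≤ n → ((p : ZMod (p ^ m)) ^ (m - 1)) ∣ a i}

/-- The affine group `AG(p^m)`: all permutations `x ↦ a x + b` of `ZMod (p^m)`
with `a` a unit. -/
def AGSet (p m : ℕ) : Set (Equiv.Perm (ZMod (p ^ m))) :=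
  {f | ∃ a b : ZMod (p ^ m), IsUnit a ∧ ∀ x, f x = a * x + b}

open Polynomial in
/-- A sum `a₀ + a₁ x + ⋯ + aₙ xⁿ` with `P ∣ aᵢ` for `2 ≤ i ≤ n` is affine up to `P` times a
polynomial of degree at most `n`. -/
theorem exists_polynomial_of_dvd_coeff {R : Type*} [CommRing R] {P : R} {n : ℕ} (hn : 1 ≤ n)
    {a : ℕ → R} (ha : ∀ i, 2 ≤ i → i ≤ n → P ∣ a i) :
    ∃ g : R[X], g.natDegree ≤ n ∧
      ∀ x, ∑ i ∈ Finset.range (n + 1), a i * x ^ i = a 0 + a 1 * x + P * g.eval x := by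
  obtain ⟨k, rfl⟩ : ∃ k, n = k + 1 := ⟨n - 1, by omega⟩
  have h : ∀ i, ∃ d, i < k → a (i + 2) = P * d := fun i => by
    by_cases hi : i < k
    · obtain ⟨d, hd⟩ := ha (i + 2) (by omega) (by omega)
      exact ⟨d, fun _ => hd⟩
    · exact ⟨0, fun h => absurd h hi⟩
  choose d hd using h
  refine ⟨∑ i ∈ Finset.range k, C (d i) * X ^ (i + 2), ?_, fun x => ?_⟩
  · refine natDegree_sum_le_of_forall_le _ _ fun i hi => (natDegree_C_mul_X_pow_le _ _).trans ?_
    have := Finset.mem_range.1 hi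
    omega
  · rw [Finset.sum_range_succ', Finset.sum_range_succ', eval_finsetSum, Finset.mul_sum]
    have : ∀ i ∈ Finset.range k, a (i + 1 + 1) * x ^ (i + 1 + 1)
        = P * eval x (C (d i) * X ^ (i + 2)) := fun i hi => by
      rw [hd i (Finset.mem_range.1 hi)]
      simp [mul_assoc]
    rw [Finset.sum_congr rfl this]
    ring

open Polynomial in
/-- An affine map plus `P` times a polynomial, written through its coefficients. -/
theorem add_mul_eval_eq_sum_range {R : Type*} [CommRing R] {P : R} {n : ℕ} (hn : 1 ≤ n)
    (b u : R) {g : R[X]} (hg : g.natDegree ≤ n) (x : R) :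
    b + u * x + P * g.eval x = ∑ i ∈ Finset.range (n + 1),
      ((if i = 0 then b else if i = 1 then u else 0) + P * g.coeff i) * x ^ i := by
  obtain ⟨k, rfl⟩ : ∃ k, n = k + 1 := ⟨n - 1, by omega⟩
  rw [eval_eq_sum_range' (Nat.lt_succ_of_le hg)]
  simp only [add_mul, Finset.sum_add_distrib, Finset.mul_sum, mul_assoc]
  congr 1
  rw [Finset.sum_range_succ', Finset.sum_range_succ']
  simp [add_comm]

open Polynomial in
theorem natDegree_taylor_sub_le {R : Type*} [CommRing R] (c : R) {h : R[X]} {n : ℕ}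
    (hh : h.natDegree ≤ n + 1) : (taylor c h - h).natDegree ≤ n := by
  rw [natDegree_le_iff_coeff_eq_zero]
  intro N hN
  rw [coeff_sub, sub_eq_zero]
  rcases eq_or_lt_of_le (show h.natDegree ≤ N by omega) with rfl | hlt
  · simp [coeff_taylor_natDegree]
  · rw [coeff_eq_zero_of_natDegree_lt hlt, coeff_eq_zero_of_natDegree_lt (by simpa using hlt)]

open Polynomial in
/-- Discrete antiderivatives exist in degrees whose successors are invertible. -/
theorem exists_taylor_one_sub_eq {R : Type*} [CommRing R] (n : ℕ)
    (hu : ∀ k, 1 ≤ k → k ≤ n + 1 → IsUnit (k : R)) (g : R[X]) (hg : g.natDegree ≤ n) :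
    ∃ G : R[X], G.natDegree ≤ n + 1 ∧ taylor 1 G - G = g := by
  induction n generalizing g with
  | zero =>
    refine ⟨C (g.coeff 0) * X, (natDegree_C_mul_le _ _).trans natDegree_X_le, ?_⟩
    conv_rhs => rw [eq_C_of_natDegree_le_zero hg]
    simp [mul_add]
  | succ n ih =>
    obtain ⟨v, hv⟩ := (hu (n + 2) (by omega) (by omega)).exists_left_inv
    set G₀ : R[X] := C (g.coeff (n + 1) * v) * X ^ (n + 2) with hG₀
    have hG₀d : G₀.natDegree ≤ n + 2 := natDegree_C_mul_X_pow_le _ _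
    have hD : (taylor 1 G₀ - G₀).natDegree ≤ n + 1 := natDegree_taylor_sub_le 1 hG₀d
    have hc : (taylor 1 G₀ - G₀).coeff (n + 1) = g.coeff (n + 1) := by
      have : (taylor 1 G₀) = C (g.coeff (n + 1) * v) * (X + 1) ^ (n + 2) := by
        simp [hG₀, taylor_apply]
      rw [coeff_sub, this, hG₀, coeff_C_mul, coeff_C_mul, coeff_X_add_one_pow, coeff_X_pow]
      have : (n + 2).choose (n + 1) = n + 2 := Nat.choose_succ_self_right (n + 1)
      rw [this, if_neg (by omega), mul_assoc, hv]
      ring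
    obtain ⟨G, hG, hGe⟩ := ih (fun k h1 h2 => hu k h1 (by omega)) (g - (taylor 1 G₀ - G₀)) <| by
      rw [natDegree_le_iff_coeff_eq_zero]
      intro N hN
      rcases eq_or_lt_of_le (show n + 1 ≤ N from hN) with rfl | hlt
      · rw [coeff_sub, hc, sub_self]
      · rw [coeff_sub, coeff_eq_zero_of_natDegree_lt (by omega),
          coeff_eq_zero_of_natDegree_lt (by omega), sub_self]
    refine ⟨G + G₀, natDegree_add_le_of_degree_le (by omega) hG₀d, ?_⟩
    rw [map_add]
    linear_combination hGe

open Polynomial in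
theorem mul_eval_eq_of_dvd_sub {R : Type*} [CommRing R] {P q : R} (hPq : P * q = 0) {x y : R}
    (h : q ∣ x - y) (g : R[X]) : P * g.eval x = P * g.eval y := by
  obtain ⟨t, ht⟩ := h.trans (sub_dvd_eval_sub x y g)
  linear_combination P * ht + t * hPq

open Polynomial in
theorem mem_QSet_iff {p m n : ℕ} (hm : 1 < m) (hn : 1 ≤ n) {f : Equiv.Perm (ZMod (p ^ m))} :
    f ∈ QSet p m n ↔ ∃ (b u : ZMod (p ^ m)) (g : (ZMod (p ^ m))[X]), IsUnit u ∧
      g.natDegree ≤ n ∧ ∀ x, f x = b + u * x + (p : ZMod (p ^ m)) ^ (m - 1) * g.eval x := by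
  constructor
  · rintro ⟨a, hf, hu, ha⟩
    obtain ⟨g, hg, hs⟩ := exists_polynomial_of_dvd_coeff hn ha
    exact ⟨a 0, a 1, g, hu, hg, fun x => (hf x).trans (hs x)⟩
  · rintro ⟨b, u, g, hu, hg, hf⟩
    refine ⟨_, fun x => (hf x).trans (add_mul_eval_eq_sum_range hn b u hg x), ?_, ?_⟩
    · have hnil : IsNilpotent ((p : ZMod (p ^ m)) ^ (m - 1) * g.coeff 1) :=
        (Commute.all _ _).isNilpotent_mul_right
          (IsNilpotent.pow_of_pos ⟨m, by exact_mod_cast ZMod.natCast_self (p ^ m)⟩ (by omega))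
      simpa using hnil.isUnit_add_left_of_commute hu (Commute.all _ _)
    · intro i hi _
      rw [if_neg (by omega), if_neg (by omega), zero_add]
      exact dvd_mul_right _ _

open Polynomial in
theorem mem_Q1Set_iff {p m n : ℕ} (hm : 1 < m) (hn : 1 ≤ n) {f : Equiv.Perm (ZMod (p ^ m))} :
    f ∈ Q1Set p m n ↔ ∃ (b : ZMod (p ^ m)) (g : (ZMod (p ^ m))[X]),
      g.natDegree ≤ n ∧ ∀ x, f x = b + x + (p : ZMod (p ^ m)) ^ (m - 1) * g.eval x := by
  constructor
  · rintro ⟨a, hf, -, ⟨d, hd⟩, ha⟩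
    obtain ⟨g, hg, hs⟩ := exists_polynomial_of_dvd_coeff hn ha
    refine ⟨a 0, C d * X + g,
      natDegree_add_le_of_degree_le ((natDegree_C_mul_le _ _).trans (natDegree_X_le.trans hn)) hg, fun x => ?_⟩
    rw [hf, hs]
    simp only [eval_add, eval_mul, eval_C, eval_X]
    linear_combination x * hd
  · rintro ⟨b, g, hg, hf⟩
    have hf' : ∀ x, f x = b + 1 * x + (p : ZMod (p ^ m)) ^ (m - 1) * g.eval x := by simpa using hf
    refine ⟨_, fun x => (hf' x).trans (add_mul_eval_eq_sum_range hn b 1 hg x), ?_, ?_, ?_⟩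
    · have hnil : IsNilpotent ((p : ZMod (p ^ m)) ^ (m - 1) * g.coeff 1) :=
        (Commute.all _ _).isNilpotent_mul_right
          (IsNilpotent.pow_of_pos ⟨m, by exact_mod_cast ZMod.natCast_self (p ^ m)⟩ (by omega))
      simpa using hnil.isUnit_add_left_of_commute isUnit_one (Commute.all _ _)
    · simp
    · intro i hi _
      rw [if_neg (by omega), if_neg (by omega), zero_add]
      exact dvd_mul_right _ _

theorem pow_pred_mul_natCast_self {p m : ℕ} (hm : 1 < m) :
    (p : ZMod (p ^ m)) ^ (m - 1) * p = 0 := by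
  rw [← pow_succ, Nat.sub_add_cancel hm.le]
  exact_mod_cast ZMod.natCast_self (p ^ m)

open Polynomial in
theorem inv_mem_QSet {p m n : ℕ} (hm : 1 < m) (hn : 1 ≤ n) {σ : Equiv.Perm (ZMod (p ^ m))}
    (hσ : σ ∈ QSet p m n) : σ⁻¹ ∈ QSet p m n := by
  rw [mem_QSet_iff hm hn] at hσ ⊢
  obtain ⟨b, u, g, hu, hg, hf⟩ := hσ
  obtain ⟨v, hv⟩ := hu.exists_left_inv
  refine ⟨-(v * b), v, C (-v) * g.comp (C v * (X - C b)), IsUnit.of_mul_eq_one _ hv, ?_, fun y => ?_⟩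
  · refine (natDegree_C_mul_le _ _).trans (natDegree_comp_le.trans ?_)
    calc _ ≤ n * 1 := Nat.mul_le_mul hg
          ((natDegree_C_mul_le _ _).trans (natDegree_X_sub_C_le b))
      _ = n := mul_one n
  · obtain ⟨x, rfl⟩ := σ.surjective y
    have hdvd : (p : ZMod (p ^ m)) ∣ v * (σ x - b) - x := by
      have : v * (σ x - b) - x = (p : ZMod (p ^ m)) ^ (m - 1) * (v * g.eval x) := by
        rw [hf]
        linear_combination x * hv
      rw [this]
      exact (dvd_pow_self _ (by omega)).mul_right _
    have key := mul_eval_eq_of_dvd_sub (pow_pred_mul_natCast_self hm) hdvd g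
    simp only [Equiv.Perm.inv_def, Equiv.symm_apply_apply, eval_mul, eval_C, eval_comp, eval_sub,
      eval_X]
    linear_combination v * key - v * hf x - x * hv

open Polynomial in
theorem conj_mem_Q1Set {p m n : ℕ} (hm : 1 < m) (hn : 1 ≤ n) {σ f : Equiv.Perm (ZMod (p ^ m))}
    (hσ : σ ∈ QSet p m (n + 1)) (hf : f ∈ Q1Set p m n) : σ * f * σ⁻¹ ∈ Q1Set p m n := by
  rw [mem_QSet_iff hm (by omega)] at hσ
  rw [mem_Q1Set_iff hm hn] at hf ⊢
  obtain ⟨b, u, h, hu, hh, hσ⟩ := hσ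
  obtain ⟨c, g, hg, hf⟩ := hf
  obtain ⟨v, hv⟩ := hu.exists_left_inv
  have hpP : (p : ZMod (p ^ m)) ∣ (p : ZMod (p ^ m)) ^ (m - 1) := dvd_pow_self _ (by omega)
  refine ⟨u * c, (C u * g + (taylor c h - h)).comp (C v * (X - C b)), ?_, fun y => ?_⟩
  · refine natDegree_comp_le.trans ?_
    calc _ ≤ n * 1 := Nat.mul_le_mul
          (natDegree_add_le_of_degree_le ((natDegree_C_mul_le _ _).trans hg)
            (natDegree_taylor_sub_le c hh))
          ((natDegree_C_mul_le _ _).trans (natDegree_X_sub_C_le b))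
      _ = n := mul_one n
  · obtain ⟨x, rfl⟩ := σ.surjective y
    have hdvd : (p : ZMod (p ^ m)) ∣ v * (σ x - b) - x := by
      have : v * (σ x - b) - x = (p : ZMod (p ^ m)) ^ (m - 1) * (v * h.eval x) := by
        rw [hσ]
        linear_combination x * hv
      rw [this]
      exact hpP.mul_right _
    have key := mul_eval_eq_of_dvd_sub (pow_pred_mul_natCast_self hm) hdvd
      (C u * g + (taylor c h - h))
    have hdvd' : (p : ZMod (p ^ m)) ∣ f x - (x + c) := by
      have : f x - (x + c) = (p : ZMod (p ^ m)) ^ (m - 1) * g.eval x := by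
        rw [hf]
        ring
      rw [this]
      exact hpP.mul_right _
    have key' := mul_eval_eq_of_dvd_sub (pow_pred_mul_natCast_self hm) hdvd' h
    simp only [eval_add, eval_sub, eval_mul, eval_C, taylor_eval] at key
    simp only [Equiv.Perm.mul_apply, Equiv.Perm.inv_def, Equiv.symm_apply_apply, eval_mul, eval_C,
      eval_comp, eval_sub, eval_X, eval_add, taylor_eval]
    linear_combination hσ (f x) - hσ x + u * hf x + key' - key

open Polynomial in
/-- A permutation conjugating the translation `x ↦ x + 1` into `Q₁^n` lies in `Q^(n+1)`. -/
theorem mem_QSet_of_conj_addRight_mem {p m n : ℕ} (hp : p.Prime) (hm : 1 < m) (hn1 : 1 ≤ n)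
    (hnp : n < p - 1) {σ : Equiv.Perm (ZMod (p ^ m))}
    (h : σ * Equiv.addRight 1 * σ⁻¹ ∈ Q1Set p m n) : σ ∈ QSet p m (n + 1) := by
  have : NeZero (p ^ m) := ⟨pow_ne_zero _ hp.ne_zero⟩
  rw [mem_Q1Set_iff hm hn1] at h
  obtain ⟨c, g, hg, hF⟩ := h
  have hstep : ∀ x, σ (x + 1) = c + σ x + (p : ZMod (p ^ m)) ^ (m - 1) * g.eval (σ x) := by
    intro x
    simpa using hF (σ x)
  have hpP : (p : ZMod (p ^ m)) ∣ (p : ZMod (p ^ m)) ^ (m - 1) := dvd_pow_self _ (by omega)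
  have hmod : ∀ k : ℕ, (p : ZMod (p ^ m)) ∣ σ k - (σ 0 + c * k) := by
    intro k
    induction k with
    | zero => simp
    | succ k ih =>
      have : σ ((k + 1 : ℕ) : ZMod (p ^ m)) - (σ 0 + c * (k + 1 : ℕ))
          = (σ k - (σ 0 + c * k)) + (p : ZMod (p ^ m)) ^ (m - 1) * g.eval (σ k) := by
        push_cast
        rw [hstep]
        ring
      rw [this]
      exact dvd_add ih (hpP.mul_right _)
  have hc : IsUnit c := by
    obtain ⟨x, hx⟩ := σ.surjective (σ 0 + 1)
    obtain ⟨t, ht⟩ := hmod x.val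
    rw [ZMod.natCast_zmod_val, hx] at ht
    have hnil : IsNilpotent ((p : ZMod (p ^ m)) * t) :=
      (Commute.all _ _).isNilpotent_mul_right
        ⟨m, by exact_mod_cast ZMod.natCast_self (p ^ m)⟩
    have : c * x = 1 - p * t := by linear_combination -ht
    exact isUnit_of_mul_isUnit_left (this ▸ hnil.isUnit_one_sub)
  have hunit : ∀ k, 1 ≤ k → k ≤ n + 1 → IsUnit (k : ZMod (p ^ m)) := fun k h1 h2 => by
    rw [ZMod.isUnit_iff_coprime]
    exact (Nat.coprime_of_lt_prime (by omega) (by omega) hp).symm.pow_right m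
  obtain ⟨G, hG, hGe⟩ := exists_taylor_one_sub_eq n hunit (g.comp (C c * X + C (σ 0))) <| by
    refine natDegree_comp_le.trans ?_
    calc _ ≤ n * 1 := Nat.mul_le_mul hg natDegree_linear_le
      _ = n := mul_one n
  have hGs : ∀ x, G.eval (x + 1) - G.eval x = g.eval (c * x + σ 0) := fun x => by
    have := congrArg (eval x) hGe
    simpa [taylor_eval, add_comm] using this
  rw [mem_QSet_iff hm (by omega)]
  refine ⟨σ 0 - (p : ZMod (p ^ m)) ^ (m - 1) * G.eval 0, c, G, hc, hG, fun x => ?_⟩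
  rw [← ZMod.natCast_zmod_val x]
  induction x.val with
  | zero => simp
  | succ k ih =>
    have key := mul_eval_eq_of_dvd_sub (pow_pred_mul_natCast_self hm) (hmod k) g
    rw [add_comm (σ 0)] at key
    push_cast
    linear_combination hstep k + ih + key - (p : ZMod (p ^ m)) ^ (m - 1) * hGs k

/-- For an odd prime `p`, `m > 1`, and `1 ≤ n < p - 1`, the normalizer of `Q₁^n`
in `S_{p^m}` equals `Q^(n+1)`. -/
theorem stmt_8 (p m n : ℕ) (hp : p.Prime) (hodd : Odd p) (hm : 1 < m)
    (hn1 : 1 ≤ n) (hnp : n < p - 1) :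
    {σ : Equiv.Perm (ZMod (p ^ m)) |
      ∀ f, σ * f * σ⁻¹ ∈ Q1Set p m n ↔ f ∈ Q1Set p m n} = QSet p m (n + 1) := by
  ext σ
  refine ⟨fun h => mem_QSet_of_conj_addRight_mem hp hm hn1 hnp ((h _).2 ?_), fun hσ f =>
    ⟨fun h => ?_, conj_mem_Q1Set hm hn1 hσ⟩⟩
  · rw [mem_Q1Set_iff hm hn1]
    exact ⟨1, 0, by simp, fun x => by simp [add_comm]⟩
  · have := conj_mem_Q1Set hm hn1 (inv_mem_QSet hm (by omega) hσ) h
    simpa [mul_assoc] using this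
end

section
/- Let p be an odd prime and m > 1. Then Q_1^1 is a normal subgroup of Q^1 = AG(p^m), and Q_1^1 is the unique subgroup of S_{p^m} of order p^{m+1} containing T: every subgroup S of S_{p^m} with |S| = p^{m+1} and T ∈ S satisfies S = Q_1^1. -/
theorem mem_Q1Set_one_iff {p m : ℕ} {f : Equiv.Perm (ZMod (p ^ m))} :
    f ∈ Q1Set p m 1 ↔ ∃ a b : ZMod (p ^ m), IsUnit a ∧
      ((p : ZMod (p ^ m)) ^ (m - 1)) ∣ (a - 1) ∧ ∀ x, f x = b + a * x := by
  constructor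
  · rintro ⟨a, hf, hu, hd, -⟩
    exact ⟨a 1, a 0, hu, hd, fun x => by rw [hf x]; simp [Finset.sum_range_succ]⟩
  · rintro ⟨a, b, hu, hd, hf⟩
    refine ⟨fun i => if i = 0 then b else a, fun x => ?_, by simpa using hu, by simpa using hd,
      fun i h2 h1 => by omega⟩
    rw [hf x]
    simp [Finset.sum_range_succ]

theorem mul_mul_inv_mem_Q1Set_one {p m : ℕ} {g f : Equiv.Perm (ZMod (p ^ m))}
    (hg : g ∈ QSet p m 1) (hf : f ∈ Q1Set p m 1) : g * f * g⁻¹ ∈ Q1Set p m 1 := by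
  obtain ⟨c, hc, -, -⟩ := hg
  obtain ⟨a, b, hu, hd, hf⟩ := mem_Q1Set_one_iff.1 hf
  have hc' : ∀ x, g x = c 0 + c 1 * x := fun x => by
    rw [hc x]; simp [Finset.sum_range_succ]
  refine mem_Q1Set_one_iff.2 ⟨a, c 0 + c 1 * b - a * c 0, hu, hd, fun x => ?_⟩
  have hx : c 0 + c 1 * g⁻¹ x = x := by rw [← hc']; simp
  rw [Equiv.Perm.mul_apply, Equiv.Perm.mul_apply, hc', hf]
  linear_combination a * hx

theorem ZMod.prime_pow_dvd_sub_one_of_pow_eq_one {p m : ℕ} (hp : p.Prime) (hodd : Odd p)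
    (hm : 0 < m) {a : ZMod (p ^ m)} (ha : a ^ p = 1) :
    ((p : ZMod (p ^ m)) ^ (m - 1)) ∣ (a - 1) := by
  have := Fact.mk hp
  obtain ⟨n, rfl⟩ := ZMod.intCast_surjective a
  have h1 : ((p : ℤ) ^ m) ∣ n ^ p - 1 ^ p := by
    have h : ((n ^ p - 1 ^ p : ℤ) : ZMod (p ^ m)) = 0 := by
      push_cast; rw [ha]; simp
    rw [ZMod.intCast_zmod_eq_zero_iff_dvd] at h
    exact_mod_cast h
  have h2 : (p : ℤ) ∣ n - 1 := by
    have h : ((n ^ p - 1 ^ p : ℤ) : ZMod p) = 0 :=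
      (ZMod.intCast_zmod_eq_zero_iff_dvd _ p).2 ((dvd_pow_self _ hm.ne').trans h1)
    rw [← ZMod.intCast_zmod_eq_zero_iff_dvd]
    push_cast at h ⊢
    rwa [ZMod.pow_card, ZMod.pow_card] at h
  have h3 : ¬ (p : ℤ) ∣ n := fun h => by
    have h' := dvd_sub h h2
    rw [sub_sub_cancel] at h'
    exact (Nat.prime_iff_prime_int.1 hp).not_isUnit (isUnit_of_dvd_one h')
  have h4 := Int.emultiplicity_pow_sub_pow hp hodd h2 h3 p
  have h5 : ((p : ℤ) ^ (m - 1)) ∣ n - 1 := by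
    rw [pow_dvd_iff_le_emultiplicity] at h1 ⊢
    rw [h4, (Nat.finiteMultiplicity_iff.2 ⟨hp.ne_one, hp.pos⟩).emultiplicity_self] at h1
    obtain ⟨k, rfl⟩ : ∃ k, m = k + 1 := ⟨m - 1, by omega⟩
    push_cast at h1
    simpa using (ENat.add_le_add_iff_right (by simp)).1 h1
  have h6 := map_dvd (Int.castRingHom (ZMod (p ^ m))) h5
  simpa using h6

theorem addRight_one_pow {p m : ℕ} (k : ℕ) :
    Equiv.addRight (1 : ZMod (p ^ m)) ^ k = Equiv.addRight (k : ZMod (p ^ m)) := by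
  ext1 x
  simp

theorem addRight_one_zpow {p m : ℕ} (k : ℤ) :
    Equiv.addRight (1 : ZMod (p ^ m)) ^ k = Equiv.addRight (k : ZMod (p ^ m)) := by
  ext1 x
  simp

theorem orderOf_addRight_one {p m : ℕ} :
    orderOf (Equiv.addRight (1 : ZMod (p ^ m))) = p ^ m := by
  have key : ∀ k : ℕ, Equiv.addRight (1 : ZMod (p ^ m)) ^ k = 1 ↔ p ^ m ∣ k := fun k => by
    rw [addRight_one_pow, ← ZMod.natCast_eq_zero_iff]
    constructor
    · intro h
      simpa using congrArg (fun e : Equiv.Perm (ZMod (p ^ m)) => e 0) h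
    · intro h
      ext1 x
      simp [h]
  exact Nat.dvd_antisymm (orderOf_dvd_iff_pow_eq_one.2 ((key _).2 dvd_rfl))
    ((key _).1 (pow_orderOf_eq_one _))

theorem finite_Q1Set_one {p m : ℕ} (hp : p.Prime) : (Q1Set p m 1).Finite := by
  have : NeZero (p ^ m) := ⟨pow_ne_zero _ hp.ne_zero⟩
  exact Set.toFinite _

theorem ncard_Q1Set_one_le {p m : ℕ} (hp : p.Prime) (hm : 0 < m) :
    (Q1Set p m 1).ncard ≤ p ^ (m + 1) := by
  have : NeZero p := ⟨hp.ne_zero⟩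
  have hfin : (Set.univ : Set (Fin p × ZMod (p ^ m))).Finite := Set.toFinite _
  let F : Fin p × ZMod (p ^ m) → ZMod (p ^ m) → ZMod (p ^ m) :=
    fun c x => c.2 + (1 + (p : ZMod (p ^ m)) ^ (m - 1) * ((c.1 : ℕ) : ZMod (p ^ m))) * x
  have hsub : (fun f : Equiv.Perm (ZMod (p ^ m)) => (f : ZMod (p ^ m) → ZMod (p ^ m))) ''
      Q1Set p m 1 ⊆ F '' Set.univ := by
    rintro _ ⟨f, hf, rfl⟩
    obtain ⟨a, b, -, ⟨c, hc⟩, hf⟩ := mem_Q1Set_one_iff.1 hf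
    obtain ⟨n, rfl⟩ := ZMod.natCast_zmod_surjective c
    refine ⟨(⟨n % p, Nat.mod_lt _ hp.pos⟩, b), trivial, ?_⟩
    have hz : (p : ZMod (p ^ m)) ^ (m - 1) * p = 0 := by
      rw [← pow_succ, Nat.sub_add_cancel hm]
      exact_mod_cast ZMod.natCast_self (p ^ m)
    have hn : (n : ZMod (p ^ m)) = ((n % p : ℕ) : ZMod (p ^ m)) + p * ((n / p : ℕ)) := by
      exact_mod_cast congrArg (Nat.cast : ℕ → ZMod (p ^ m)) (Nat.mod_add_div n p).symm
    funext x
    simp only [F, hf]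
    rw [hn] at hc
    linear_combination (-x) * hc - x * ((n / p : ℕ) : ZMod (p ^ m)) * hz
  calc (Q1Set p m 1).ncard = _ := (Set.ncard_image_of_injective _ DFunLike.coe_injective).symm
    _ ≤ (F '' Set.univ).ncard := Set.ncard_le_ncard hsub (hfin.image _)
    _ ≤ (Set.univ : Set (Fin p × ZMod (p ^ m))).ncard := Set.ncard_image_le hfin
    _ = p ^ (m + 1) := by
      rw [Set.ncard_univ, Nat.card_prod, Nat.card_fin, Nat.card_zmod, pow_succ']

theorem subset_Q1Set_one {p m : ℕ} (hp : p.Prime) (hodd : Odd p) (hm : 0 < m)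
    {S : Subgroup (Equiv.Perm (ZMod (p ^ m)))} (hS : Nat.card S = p ^ (m + 1))
    (hT : Equiv.addRight (1 : ZMod (p ^ m)) ∈ S) :
    (S : Set (Equiv.Perm (ZMod (p ^ m)))) ⊆ Q1Set p m 1 := by
  have : NeZero (p ^ m) := ⟨pow_ne_zero _ hp.ne_zero⟩
  let N : Subgroup S := Subgroup.zpowers ⟨Equiv.addRight 1, hT⟩
  have mem_N : ∀ g : S, g ∈ N → ∃ c, (g : Equiv.Perm (ZMod (p ^ m))) = Equiv.addRight c := by
    rintro g ⟨k, rfl⟩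
    exact ⟨k, addRight_one_zpow k⟩
  have hcard : Nat.card N = p ^ m := by
    rw [Nat.card_zpowers, Subgroup.orderOf_mk, orderOf_addRight_one]
  have hindex : N.index = p := by
    have h := N.card_mul_index
    rw [hcard, hS, pow_succ] at h
    exact Nat.eq_of_mul_eq_mul_left (pow_pos hp.pos m) h
  have : N.Normal := Subgroup.normal_of_index_eq_minFac_card (by
    rw [hindex, hS, Nat.pow_minFac (by omega), hp.minFac_eq])
  intro f hf
  obtain ⟨a, ha⟩ : ∃ a, ∀ x, f (x + 1) = f x + a := by
    obtain ⟨a, ha⟩ := mem_N _ (‹N.Normal›.conj_mem _ (Subgroup.mem_zpowers _) ⟨f, hf⟩)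
    refine ⟨a, fun x => ?_⟩
    simpa using congrArg (fun e : Equiv.Perm (ZMod (p ^ m)) => e (f x)) ha
  have hfa : ∀ x, f x = f 0 + a * x := by
    intro x
    obtain ⟨n, rfl⟩ := ZMod.natCast_zmod_surjective x
    induction n with
    | zero => simp
    | succ n ih => push_cast; rw [ha, ih]; ring
  let t : Equiv.Perm (ZMod (p ^ m)) := Equiv.addRight (-f 0)
  have ht : t ∈ S := by
    obtain ⟨n, hn⟩ := ZMod.natCast_zmod_surjective (-f 0)
    have := S.pow_mem hT n
    rwa [addRight_one_pow, hn] at this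
  have hpow : ∀ (n : ℕ) (x : ZMod (p ^ m)), ((t * f) ^ n) x = a ^ n * x := by
    intro n
    induction n with
    | zero => simp
    | succ n ih =>
      intro x
      rw [pow_succ, Equiv.Perm.mul_apply, ih, Equiv.Perm.mul_apply, hfa x]
      simp only [t, Equiv.coe_addRight]
      ring
  have hap : a ^ p = 1 := by
    have h := N.pow_index_mem ⟨t * f, S.mul_mem ht hf⟩
    rw [hindex] at h
    obtain ⟨c, hc⟩ := mem_N _ h
    have hc' : ∀ x, a ^ p * x = x + c := fun x => by
      rw [← hpow]
      exact congrArg (fun e : Equiv.Perm (ZMod (p ^ m)) => e x) hc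
    have h0 := hc' 0
    have h1 := hc' 1
    linear_combination h1 - h0
  exact mem_Q1Set_one_iff.2 ⟨a, f 0, IsUnit.of_pow_eq_one hap hp.ne_zero,
    ZMod.prime_pow_dvd_sub_one_of_pow_eq_one hp hodd hm hap, hfa⟩

/-- For an odd prime `p` and `m > 1`: `Q₁^1` is normal in `Q^1 = AG(p^m)`, and every
subgroup `S ≤ S_{p^m}` of order `p^(m+1)` containing the translation `T` equals `Q₁^1`. -/
theorem stmt_10 (p m : ℕ) (hp : p.Prime) (hodd : Odd p) (hm : 1 < m) :
    (∀ g ∈ QSet p m 1, ∀ f ∈ Q1Set p m 1, g * f * g⁻¹ ∈ Q1Set p m 1) ∧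
    (∀ S : Subgroup (Equiv.Perm (ZMod (p ^ m))),
      Nat.card S = p ^ (m + 1) → Equiv.addRight (1 : ZMod (p ^ m)) ∈ S →
      (S : Set (Equiv.Perm (ZMod (p ^ m)))) = Q1Set p m 1) := by
  refine ⟨fun g hg f hf => mul_mul_inv_mem_Q1Set_one hg hf, fun S hS hT => ?_⟩
  refine Set.eq_of_subset_of_ncard_le (subset_Q1Set_one hp hodd (by omega) hS hT) ?_
    (finite_Q1Set_one hp)
  exact (ncard_Q1Set_one_le hp (by omega)).trans (hS.symm.trans (Nat.card_coe_set_eq _)).le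
end
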